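/- Let n ≥ 3 and let φ(x,y) be a p-encoding with n input variables x=(x_1,…,x_n). Suppose that for some i ∈ {1,…,n} the set Q_i of clauses of φ containing ¬x_i satisfies |Q_i| = 1. Then there is a p-encoding φ' with input variables x satisfying |φ| ≥ |φ'| + 1; moreover, if φ is a 2-CNF formula, then φ' can be taken to be a 2-CNF formula. -/

import Mathlib

/-- A literal is a variable together with a polarity (`true` = positive). -/
abbrev Lit (V : Type) := V × Bool

/-- The negation of a literal. -/
def negLit {V : Type} (l : Lit V) : Lit V := (l.1, !l.2)

/-- A clause is a finite set of literals. -/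
abbrev Clause (V : Type) := Finset (Lit V)

/-- A CNF formula is a finite set of clauses. -/
abbrev CNF (V : Type) := Finset (Clause V)

/-- A clause proper contains no complementary pair of literals. -/
def IsClause {V : Type} [DecidableEq V] (C : Clause V) : Prop := ∀ l ∈ C, negLit l ∉ C

instance {V : Type} [DecidableEq V] (C : Clause V) : Decidable (IsClause C) := by
  unfold IsClause; infer_instance

/-- A CNF formula proper consists of proper clauses. -/
def IsCNF {V : Type} [DecidableEq V] (φ : CNF V) : Prop := ∀ C ∈ φ, IsClause C

/-- Satisfaction of a literal by an assignment. -/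
def LitSat {V : Type} (α : V → Bool) (l : Lit V) : Prop := α l.1 = l.2

/-- Satisfaction of a clause by an assignment. -/
def ClauseSat {V : Type} (α : V → Bool) (C : Clause V) : Prop := ∃ l ∈ C, LitSat α l

/-- Satisfaction of a CNF formula by an assignment. -/
def CnfSat {V : Type} (α : V → Bool) (φ : CNF V) : Prop := ∀ C ∈ φ, ClauseSat α C

/-- `UnitDerives φ C` : the clause `C` can be derived from `φ` by a series of unit
resolutions (each step resolves a derived unit clause with another derived clause). -/
inductive UnitDerives {V : Type} [DecidableEq V] (φ : CNF V) : Clause V → Prop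
  | base {C : Clause V} (h : C ∈ φ) : UnitDerives φ C
  | step {l : Lit V} {C : Clause V} (h1 : UnitDerives φ {l})
      (h2 : UnitDerives φ C) (h3 : negLit l ∈ C) :
      UnitDerives φ (C.erase (negLit l))

/-- The formula `φ ∧ l` (adding a unit clause). -/
def addUnit {V : Type} [DecidableEq V] (φ : CNF V) (l : Lit V) : CNF V :=
  insert {l} φ

/-- The formula `φ ∧ g₁ ∧ … ∧ g_p` (adding finitely many unit clauses). -/
def addUnits {V : Type} [DecidableEq V] (φ : CNF V) (L : Finset (Lit V)) : CNF V :=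
  φ ∪ L.image (fun l => ({l} : Clause V))

/-- Variables: `n` input variables and `ℓ` auxiliary variables. -/
abbrev Var (n ℓ : ℕ) : Type := Sum (Fin n) (Fin ℓ)

/-- The literal on the `i`-th input variable with polarity `b`. -/
def inLit {n ℓ : ℕ} (i : Fin n) (b : Bool) : Lit (Var n ℓ) := (Sum.inl i, b)

/-- A p-encoding: (P1) `φ ∧ x_i` is satisfiable for each input variable `x_i`, and
(P2) `φ ∧ x_i ⊢₁ ¬x_j` for all `i ≠ j`. -/
def IsPEncoding {n ℓ : ℕ} (φ : CNF (Var n ℓ)) : Prop :=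
  IsCNF φ ∧
  (∀ i : Fin n, ∃ α : Var n ℓ → Bool, CnfSat α φ ∧ α (Sum.inl i) = true) ∧
  (∀ i j : Fin n, i ≠ j →
    UnitDerives (addUnit φ (inLit i true)) {inLit j false})

/-- A p-encoding relative to a set `I` of input indices. -/
def IsPEncodingOn {n ℓ : ℕ} (φ : CNF (Var n ℓ)) (I : Finset (Fin n)) : Prop :=
  IsCNF φ ∧
  (∀ i ∈ I, ∃ α : Var n ℓ → Bool, CnfSat α φ ∧ α (Sum.inl i) = true) ∧
  (∀ i ∈ I, ∀ j ∈ I, i ≠ j →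
    UnitDerives (addUnit φ (inLit i true)) {inLit j false})

/-- 2-CNF: every clause has at most two literals. -/
def Is2CNF {V : Type} (φ : CNF V) : Prop := ∀ C ∈ φ, C.card ≤ 2

/-- The set of possible sizes of p-encodings with `n` input variables. -/
def pencSizes (n : ℕ) : Set ℕ :=
  {k | ∃ ℓ : ℕ, ∃ φ : CNF (Var n ℓ), IsPEncoding φ ∧ φ.card = k}

/-- `S n` : the minimum size of a p-encoding with `n` input variables. -/
noncomputable def S (n : ℕ) : ℕ := sInf (pencSizes n)

/-- The set of possible sizes of 2-CNF p-encodings with `n` input variables. -/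
def penc2Sizes (n : ℕ) : Set ℕ :=
  {k | ∃ ℓ : ℕ, ∃ φ : CNF (Var n ℓ), IsPEncoding φ ∧ Is2CNF φ ∧ φ.card = k}

/-- `S₂ n` : the minimum size of a 2-CNF p-encoding with `n` input variables. -/
noncomputable def S2 (n : ℕ) : ℕ := sInf (penc2Sizes n)

/-- `φ(x,y)` is an encoding of the boolean function `f(x)`. -/
def Encodes {n ℓ : ℕ} (φ : CNF (Var n ℓ)) (f : (Fin n → Bool) → Prop) : Prop :=
  IsCNF φ ∧
  ∀ α : Fin n → Bool, f α ↔ ∃ β : Fin ℓ → Bool, CnfSat (Sum.elim α β) φ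

/-- Injection of literals on input variables into literals of the encoding. -/
def inLits {n ℓ : ℕ} (G : Finset (Lit (Fin n))) : Finset (Lit (Var n ℓ)) :=
  G.image (fun g => ((Sum.inl g.1 : Var n ℓ), g.2))

/-- Propagation complete encoding of `f`: an encoding such that whenever
`f ∧ g₁ ∧ … ∧ g_p ⊨ h` for literals on input variables (`p ≥ 1`), unit propagation
from `φ ∧ g₁ ∧ … ∧ g_p` derives `h` or derives the empty clause. -/
def IsPCEncoding {n ℓ : ℕ} (φ : CNF (Var n ℓ)) (f : (Fin n → Bool) → Prop) : Prop :=
  Encodes φ f ∧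
  ∀ G : Finset (Lit (Fin n)), G.Nonempty → ∀ h : Lit (Fin n),
    (∀ α : Fin n → Bool, f α → (∀ g ∈ G, α g.1 = g.2) → α h.1 = h.2) →
    (UnitDerives (addUnits φ (inLits G)) {((Sum.inl h.1 : Var n ℓ), h.2)} ∨
     UnitDerives (addUnits φ (inLits G)) (∅ : Clause (Var n ℓ)))

/-- The "at most one" function. -/
def AMO (n : ℕ) (α : Fin n → Bool) : Prop :=
  (Finset.univ.filter fun i => α i = true).card ≤ 1

/-- The "exactly one" function. -/
def EXO (n : ℕ) (α : Fin n → Bool) : Prop :=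
  (Finset.univ.filter fun i => α i = true).card = 1

/-- `Qset φ i` : the set of clauses of `φ` containing the literal `¬x_i`. -/
def Qset {n ℓ : ℕ} (φ : CNF (Var n ℓ)) (i : Fin n) : CNF (Var n ℓ) :=
  φ.filter (fun C => inLit i false ∈ C)

/-- Regular form: for each `i`, `|Q_i| = 2`, clauses of `Q_i` contain no input variables
other than `x_i`, and all clauses of `Q_i` are binary. -/
def RegularForm {n ℓ : ℕ} (φ : CNF (Var n ℓ)) : Prop :=
  ∀ i : Fin n,
    (Qset φ i).card = 2 ∧
    (∀ C ∈ Qset φ i, ∀ j : Fin n, ∀ b : Bool, ((Sum.inl j : Var n ℓ), b) ∈ C → j = i) ∧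
    (∀ C ∈ Qset φ i, C.card = 2)

/-- `C` is an implicate of `φ`. -/
def Implicate {V : Type} (φ : CNF V) (C : Clause V) : Prop :=
  ∀ α : V → Bool, CnfSat α φ → ClauseSat α C

/-- `C` is a prime implicate of `φ`. -/
def PrimeImplicate {V : Type} (φ : CNF V) (C : Clause V) : Prop :=
  Implicate φ C ∧ ∀ C' : Clause V, C' ⊂ C → ¬ Implicate φ C'

/-- `φ` is prime: every clause of `φ` is a prime implicate of `φ`. -/
def IsPrime {V : Type} (φ : CNF V) : Prop := ∀ C ∈ φ, PrimeImplicate φ C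

/-- The set of clauses of `φ` in which the auxiliary variable `y` occurs
(as a positive or negative literal). -/
def occursIn {n ℓ : ℕ} (φ : CNF (Var n ℓ)) (y : Fin ℓ) : CNF (Var n ℓ) :=
  φ.filter (fun C => ((Sum.inr y : Var n ℓ), true) ∈ C ∨ ((Sum.inr y : Var n ℓ), false) ∈ C)

/-- The substitution `g₁ ← g₂` on a literal: `g₁ ↦ g₂`, `¬g₁ ↦ ¬g₂`,
all other literals unchanged. -/
def substLit {V : Type} [DecidableEq V] (g₁ g₂ : Lit V) (l : Lit V) : Lit V :=
  if l.1 = g₁.1 then (if l.2 = g₁.2 then g₂ else negLit g₂) else l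

/-- The substitution `g₁ ← g₂` applied to a clause. -/
def substClause {V : Type} [DecidableEq V] (g₁ g₂ : Lit V) (C : Clause V) : Clause V :=
  C.image (substLit g₁ g₂)

/-- The formula `φ[g₁ ← g₂]`: apply the substitution to every clause and remove the
clauses that became tautological (i.e. contain a complementary pair of literals). -/
def substCNF {V : Type} [DecidableEq V] (g₁ g₂ : Lit V) (φ : CNF V) : CNF V :=
  (φ.image (substClause g₁ g₂)).filter (fun C => IsClause C)

/-- `restrict φ ρ` : the formula `φ(ρ)` obtained from `φ` by the partial assignment
given by the set of literals `ρ` (clauses satisfied by `ρ` are removed, and falsified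
literals are removed from the remaining clauses). -/
def restrict {V : Type} [DecidableEq V] (φ : CNF V) (ρ : Finset (Lit V)) : CNF V :=
  (φ.filter (fun C => ∀ l ∈ ρ, l ∉ C)).image (fun C => C.filter (fun l => negLit l ∉ ρ))

/-- Literals reached by unit propagation from `φ`. -/
inductive Propagates {V : Type} (φ : CNF V) : Lit V → Prop
  | unit {l : Lit V} {C : Clause V} (hC : C ∈ φ) (hl : l ∈ C)
      (h : ∀ m ∈ C, m ≠ l → Propagates φ (negLit m)) : Propagates φ l

section Propagation

variable {V : Type}

@[simp] theorem negLit_negLit (l : Lit V) : negLit (negLit l) = l := by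
  simp [negLit]

theorem negLit_ne_self (l : Lit V) : negLit l ≠ l := by
  intro h
  have := congrArg Prod.snd h
  simp [negLit] at this

theorem litSat_negLit {α : V → Bool} {l : Lit V} : LitSat α (negLit l) ↔ ¬ LitSat α l := by
  unfold LitSat negLit
  cases α l.1 <;> cases l.2 <;> simp

theorem Propagates.litSat {φ : CNF V} {α : V → Bool} (hα : CnfSat α φ) {l : Lit V}
    (h : Propagates φ l) : LitSat α l := by
  induction h with
  | @unit l C hC hl _ ih =>
    obtain ⟨m, hm, hs⟩ := hα C hC
    by_cases hml : m = l
    · exact hml ▸ hs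
    · exact absurd hs (litSat_negLit.1 (ih m hm hml))

variable [DecidableEq V]

theorem cnfSat_addUnit {φ : CNF V} {α : V → Bool} {u : Lit V} (hα : CnfSat α φ)
    (hu : LitSat α u) : CnfSat α (addUnit φ u) := by
  intro C hC
  rcases Finset.mem_insert.1 hC with rfl | hC
  · exact ⟨u, by simp, hu⟩
  · exact hα C hC

theorem UnitDerives.exists_subset {φ : CNF V} {D : Clause V} (h : UnitDerives φ D) :
    ∃ C ∈ φ, D ⊆ C ∧ ∀ m ∈ C, m ∉ D → Propagates φ (negLit m) := by
  induction h with
  | @base C hC => exact ⟨C, hC, subset_rfl, fun m hm hm' => absurd hm hm'⟩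
  | @step l D _ _ _ ih₁ ih₂ =>
    obtain ⟨C₁, hC₁, hs₁, hp₁⟩ := ih₁
    obtain ⟨C₂, hC₂, hs₂, hp₂⟩ := ih₂
    refine ⟨C₂, hC₂, (Finset.erase_subset _ _).trans hs₂, fun m hm hmD => ?_⟩
    by_cases hml : m = negLit l
    · rw [hml, negLit_negLit]
      exact .unit hC₁ (hs₁ (by simp)) fun m hm hne => hp₁ m hm (by simpa using hne)
    · exact hp₂ m hm fun h => hmD (Finset.mem_erase.2 ⟨hml, h⟩)

theorem UnitDerives.sdiff {φ : CNF V} {C : Clause V} (hC : UnitDerives φ C) (S : Clause V)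
    (hS : ∀ m ∈ S, UnitDerives φ {negLit m}) : UnitDerives φ (C \ S) := by
  induction S using Finset.induction_on with
  | empty => simpa using hC
  | insert a S _ ih =>
    have hCS := ih fun m hm => hS m (Finset.mem_insert_of_mem hm)
    rw [Finset.sdiff_insert]
    by_cases ha : a ∈ C \ S
    · have := UnitDerives.step (hS a (Finset.mem_insert_self _ _)) hCS (by simpa using ha)
      rwa [negLit_negLit] at this
    · rwa [Finset.erase_eq_of_notMem ha]

theorem unitDerives_singleton_iff {φ : CNF V} {l : Lit V} :
    UnitDerives φ {l} ↔ Propagates φ l := by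
  constructor
  · intro h
    obtain ⟨C, hC, hs, hp⟩ := h.exists_subset
    exact .unit hC (hs (by simp)) fun m hm hne => hp m hm (by simpa using hne)
  · intro h
    induction h with
    | @unit l C hC hl _ ih =>
      have := (UnitDerives.base hC).sdiff (C.erase l) fun m hm =>
        ih m (Finset.mem_of_mem_erase hm) (Finset.ne_of_mem_erase hm)
      rwa [Finset.sdiff_erase_self hl] at this

/-- If `negLit u` occurs only in the clause `C`, then propagation from `u` either adds nothing or
passes through `C` becoming unit. -/
theorem Propagates.of_addUnit {φ : CNF V} {u : Lit V} {C : Clause V}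
    (hC : ∀ D ∈ φ, negLit u ∈ D → D = C) {l : Lit V} (h : Propagates (addUnit φ u) l) :
    l = u ∨ Propagates φ l ∨
      ∃ g ∈ C, g ≠ negLit u ∧ ∀ m ∈ C, m ≠ g → m ≠ negLit u → Propagates φ (negLit m) := by
  induction h with
  | @unit l D hD hl _ ih =>
    by_cases hg : ∃ g ∈ C, g ≠ negLit u ∧
        ∀ m ∈ C, m ≠ g → m ≠ negLit u → Propagates φ (negLit m)
    · exact .inr (.inr hg)
    rcases Finset.mem_insert.1 hD with rfl | hD
    · exact .inl (by simpa using hl)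
    have key : ∀ m ∈ D, m ≠ l → m ≠ negLit u → Propagates φ (negLit m) := by
      intro m hm hml hmu
      rcases ih m hm hml with h | h | h
      · exact absurd (by rw [← h, negLit_negLit]) hmu
      · exact h
      · exact absurd h hg
    by_cases hu : negLit u ∈ D ∧ negLit u ≠ l
    · obtain rfl := hC D hD hu.1
      exact absurd ⟨l, hl, hu.2.symm, key⟩ hg
    · exact .inr (.inl (.unit hD hl fun m hm hml =>
        key m hm hml fun h => hu ⟨h ▸ hm, h ▸ hml⟩))

/-- If the only clause `C` containing `negLit u` propagates from `u` to `g`, then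
every consequence of propagating `u` other than `u` follows from `φ` and `g`. -/
theorem Propagates.litSat_of_addUnit {φ : CNF V} {u g : Lit V} {C : Clause V}
    (hC : ∀ D ∈ φ, negLit u ∈ D → D = C)
    (hCg : ∀ m ∈ C, m ≠ g → m ≠ negLit u → Propagates φ (negLit m))
    {α β : V → Bool} (hα : CnfSat α φ) (hαu : LitSat α u) (hβ : CnfSat β φ) (hβg : LitSat β g)
    {l : Lit V} (h : Propagates (addUnit φ u) l) : l = u ∨ LitSat β l := by
  induction h with
  | @unit l D hD hl hprop ih =>
    have hαl : LitSat α l := (Propagates.unit hD hl hprop).litSat (cnfSat_addUnit hα hαu)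
    rcases Finset.mem_insert.1 hD with rfl | hD
    · exact .inl (by simpa using hl)
    refine .inr ?_
    by_cases hu : negLit u ∈ D ∧ negLit u ≠ l
    · obtain rfl := hC D hD hu.1
      by_cases hlg : l = g
      · exact hlg ▸ hβg
      · exact absurd hαl (litSat_negLit.1 ((hCg l hl hlg hu.2.symm).litSat hα))
    · obtain ⟨m, hm, hs⟩ := hβ D hD
      by_cases hml : m = l
      · exact hml ▸ hs
      rcases ih m hm hml with h | h
      · have hmu : m = negLit u := by rw [← h, negLit_negLit]
        exact absurd ⟨hmu ▸ hm, hmu ▸ hml⟩ hu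
      · exact absurd hs (litSat_negLit.1 h)

end Propagation

section Substitution

variable {V : Type} [DecidableEq V] {g₁ g₂ : Lit V}

theorem substLit_negLit (l : Lit V) :
    substLit g₁ g₂ (negLit l) = negLit (substLit g₁ g₂ l) := by
  obtain ⟨v, b⟩ := l
  obtain ⟨w, c⟩ := g₁
  by_cases h : v = w
  · cases b <;> cases c <;> simp [substLit, negLit, h]
  · simp [substLit, negLit, h]

theorem litSat_substLit {α : V → Bool} (hα : LitSat α g₁ ↔ LitSat α g₂) (l : Lit V) :
    LitSat α (substLit g₁ g₂ l) ↔ LitSat α l := by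
  obtain ⟨v, b⟩ := l
  obtain ⟨w, c⟩ := g₁
  unfold substLit
  split_ifs with h₁ h₂
  · simp only at h₁ h₂
    subst h₁ h₂
    exact hα.symm
  · simp only at h₁ h₂
    subst h₁
    rw [litSat_negLit, ← hα, ← litSat_negLit]
    cases b <;> cases c <;> simp_all [negLit]
  · rfl

theorem cnfSat_substCNF {φ : CNF V} {α : V → Bool} (hα : LitSat α g₁ ↔ LitSat α g₂)
    (hφ : CnfSat α φ) : CnfSat α (substCNF g₁ g₂ φ) := by
  intro D hD
  obtain ⟨C, hC, rfl⟩ := Finset.mem_image.1 (Finset.mem_filter.1 hD).1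
  obtain ⟨l, hl, hs⟩ := hφ C hC
  exact ⟨_, Finset.mem_image_of_mem _ hl, (litSat_substLit hα l).2 hs⟩

theorem isCNF_substCNF (φ : CNF V) : IsCNF (substCNF g₁ g₂ φ) :=
  fun _ hC => (Finset.mem_filter.1 hC).2

theorem Is2CNF.substCNF {φ : CNF V} (h : Is2CNF φ) : Is2CNF (substCNF g₁ g₂ φ) := by
  intro D hD
  obtain ⟨C, hC, rfl⟩ := Finset.mem_image.1 (Finset.mem_filter.1 hD).1
  exact Finset.card_image_le.trans (h C hC)

theorem card_substCNF_add_one_le {φ : CNF V} {C : Clause V} (hC : C ∈ φ)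
    (hC' : ¬ IsClause (substClause g₁ g₂ C)) : (substCNF g₁ g₂ φ).card + 1 ≤ φ.card := by
  have hsub : substCNF g₁ g₂ φ ⊆ (φ.erase C).image (substClause g₁ g₂) := by
    intro D hD
    obtain ⟨hD, hcl⟩ := Finset.mem_filter.1 hD
    obtain ⟨E, hE, rfl⟩ := Finset.mem_image.1 hD
    exact Finset.mem_image_of_mem _
      (Finset.mem_erase.2 ⟨fun h => hC' (h ▸ hcl), hE⟩)
  rw [← Finset.card_erase_add_one hC]
  exact Nat.add_le_add_right ((Finset.card_le_card hsub).trans Finset.card_image_le) 1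

/-- Propagation survives a substitution, provided the substituted formula is satisfiable. -/
theorem Propagates.substCNF {φ : CNF V} {u : Lit V} {α : V → Bool}
    (hα : CnfSat α (addUnit (substCNF g₁ g₂ φ) (substLit g₁ g₂ u))) {l : Lit V}
    (h : Propagates (addUnit φ u) l) :
    Propagates (addUnit (substCNF g₁ g₂ φ) (substLit g₁ g₂ u)) (substLit g₁ g₂ l) := by
  induction h with
  | @unit l D hD hl _ ih =>
    simp only [substLit_negLit] at ih
    rcases Finset.mem_insert.1 hD with rfl | hD
    · rw [Finset.mem_singleton.1 hl]
      exact .unit (Finset.mem_insert_self _ _) (Finset.mem_singleton_self _)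
        fun m hm hne => absurd (Finset.mem_singleton.1 hm) hne
    by_cases hcl : IsClause (substClause g₁ g₂ D)
    · refine .unit (Finset.mem_insert_of_mem
        (Finset.mem_filter.2 ⟨Finset.mem_image_of_mem _ hD, hcl⟩))
        (Finset.mem_image_of_mem _ hl) fun m' hm' hne => ?_
      obtain ⟨m, hm, rfl⟩ := Finset.mem_image.1 hm'
      exact ih m hm fun h => hne (h ▸ rfl)
    · unfold IsClause at hcl
      push Not at hcl
      obtain ⟨p', hp', hq'⟩ := hcl
      obtain ⟨p, hp, rfl⟩ := Finset.mem_image.1 hp'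
      obtain ⟨q, hq, hqp⟩ := Finset.mem_image.1 hq'
      have hne : q ≠ p := by
        rintro rfl
        exact negLit_ne_self _ hqp.symm
      by_cases hpl : p = l
      · subst hpl
        have := ih q hq hne
        rwa [hqp, negLit_negLit] at this
      · by_cases hql : q = l
        · subst hql
          rw [hqp]
          exact ih p hp hpl
        · have h₁ := (ih p hp hpl).litSat hα
          have h₂ := (ih q hq hql).litSat hα
          rw [hqp, negLit_negLit] at h₂
          exact absurd h₂ (litSat_negLit.1 h₁)

end Substitution

/-- Let n ≥ 3 and φ be a p-encoding with n input variables such that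
|Q_i| = 1 for some i. Then there is a p-encoding φ' with n input variables with
|φ| ≥ |φ'| + 1; if φ is 2-CNF, φ' can be taken 2-CNF. -/
theorem single_negative_occurrence (n ℓ : ℕ) (hn : 3 ≤ n) (φ : CNF (Var n ℓ))
    (hpe : IsPEncoding φ) (i : Fin n) (hQ : (Qset φ i).card = 1) :
    ∃ ℓ' : ℕ, ∃ φ' : CNF (Var n ℓ'), IsPEncoding φ' ∧ φ'.card + 1 ≤ φ.card ∧
      (Is2CNF φ → Is2CNF φ') := by
  obtain ⟨hcnf, hsat, hprop⟩ := hpe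
  simp only [unitDerives_singleton_iff] at hprop
  obtain ⟨C, hQC⟩ := Finset.card_eq_one.1 hQ
  have hC : C ∈ φ ∧ inLit i false ∈ C := by
    have : C ∈ Qset φ i := by simp [hQC]
    exact Finset.mem_filter.1 this
  have huniq : ∀ D ∈ φ, negLit (inLit i true) ∈ D → D = C := by
    intro D hD hiD
    have : D ∈ Qset φ i := Finset.mem_filter.2 ⟨hD, hiD⟩
    simpa [hQC] using this
  have exists_third (a b : Fin n) : ∃ k : Fin n, k ≠ a ∧ k ≠ b := by
    by_contra! h
    have hsub : (Finset.univ : Finset (Fin n)) ⊆ {a, b} := by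
      intro k _
      by_cases hk : k = a
      · simp [hk]
      · simp [h k hk]
    have := (Finset.card_le_card hsub).trans Finset.card_le_two
    simp only [Finset.card_univ, Fintype.card_fin] at this
    omega
  obtain ⟨α, hα, hαi⟩ := hsat i
  obtain ⟨g, hgC, hgi, hCg⟩ : ∃ g ∈ C, g ≠ negLit (inLit i true) ∧
      ∀ m ∈ C, m ≠ g → m ≠ negLit (inLit i true) → Propagates φ (negLit m) := by
    obtain ⟨j, hj, -⟩ := exists_third i i
    rcases (hprop i j hj.symm).of_addUnit huniq with h | h | h
    · simp [inLit] at h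
    · obtain ⟨β, hβ, hβj⟩ := hsat j
      have : β (Sum.inl j) = false := h.litSat hβ
      simp [hβj] at this
    · exact h
  have hgx : ∀ β, CnfSat β φ → LitSat β g → ∀ j, i ≠ j → β (Sum.inl j) = false := by
    intro β hβ hβg j hij
    rcases (hprop i j hij).litSat_of_addUnit huniq hCg hα hαi hβ hβg with h | h
    · simp [inLit] at h
    · exact h
  have hxg : ∀ β, CnfSat β φ → β (Sum.inl i) = true → LitSat β g := by
    intro β hβ hβi
    obtain ⟨m, hm, hs⟩ := hβ C hC.1
    by_cases hmg : m = g
    · exact hmg ▸ hs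
    by_cases hmi : m = negLit (inLit i true)
    · subst hmi
      exact absurd hβi (litSat_negLit.1 hs)
    · exact absurd hs (litSat_negLit.1 ((hCg m hm hmg hmi).litSat hβ))
  obtain ⟨v, b⟩ := g
  rcases v with j | y
  · exfalso
    by_cases hji : i = j
    · subst hji
      cases b
      · exact hgi rfl
      · exact hcnf C hC.1 _ hgC hC.2
    · cases b
      · obtain ⟨k, hki, hkj⟩ := exists_third i j
        obtain ⟨β, hβ, hβk⟩ := hsat k
        have hβj := (hprop k j hkj).litSat (cnfSat_addUnit (u := inLit k true) hβ hβk)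
        have := hgx β hβ hβj k hki.symm
        simp [hβk] at this
      · have h₁ : α (Sum.inl j) = true := hxg α hα hαi
        have h₂ := hgx α hα (hxg α hα hαi) j hji
        simp [h₁] at h₂
  · set g : Lit (Var n ℓ) := (Sum.inr y, b) with hg
    have hfix (j : Fin n) (c : Bool) : substLit g (inLit i true) (inLit j c) = inLit j c := by
      simp [substLit, inLit, hg]
    have hsubst_g : substLit g (inLit i true) g = inLit i true := by simp [substLit]
    have hmodel (j : Fin n) : ∃ β : Var n ℓ → Bool,
        CnfSat β (substCNF g (inLit i true) φ) ∧ β (Sum.inl j) = true := by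
      obtain ⟨β, hβ, hβj⟩ := hsat j
      refine ⟨β, cnfSat_substCNF ⟨fun h => ?_, hxg β hβ⟩ hβ, hβj⟩
      by_cases hij : i = j
      · exact hij ▸ hβj
      · have := hgx β hβ h j hij
        simp [hβj] at this
    refine ⟨ℓ, substCNF g (inLit i true) φ, ⟨isCNF_substCNF φ, hmodel, fun j k hjk => ?_⟩,
      card_substCNF_add_one_le hC.1 fun hcl => ?_, Is2CNF.substCNF⟩
    · obtain ⟨β, hβ, hβj⟩ := hmodel j
      have hβ' : CnfSat β (addUnit (substCNF g (inLit i true) φ)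
          (substLit g (inLit i true) (inLit j true))) := by
        rw [hfix]
        exact cnfSat_addUnit hβ hβj
      have := (hprop j k hjk).substCNF hβ'
      rw [hfix, hfix] at this
      exact unitDerives_singleton_iff.2 this
    · have h₁ := Finset.mem_image_of_mem (substLit g (inLit i true)) hgC
      have h₂ := Finset.mem_image_of_mem (substLit g (inLit i true)) hC.2
      rw [hsubst_g] at h₁
      rw [hfix] at h₂
      exact hcl _ h₁ h₂
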